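/- arXiv:1307.7231 — 3 statements merged into one kernel-verified Lean document; each statement's English description precedes it below -/
import Mathlib

section
/- Let 0 < ε < 1, let I be a nonempty finite set of rounds, let S be a finite set of nodes with |S| ≥ 2/ε, and for each v ∈ S let A_v ⊆ I with |A_v| ≥ ε·|I| (the non-jammed rounds of v). Let J = { t ∈ I : at most one v ∈ S has t ∈ A_v }. Then |J| ≤ (1 − ε/2)·|I|. -/
/-- Double counting of the incidences between `S` and `I`, where an index lying in at most one of
the sets `A v` contributes at most one and every other index contributes at most `S.card`. -/
theorem sum_card_le_card_filter_le_one_add {ι ν : Type*} [DecidableEq ι]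
    (I : Finset ι) (S : Finset ν) (A : ν → Finset ι) (hA : ∀ v ∈ S, A v ⊆ I) :
    ∑ v ∈ S, (A v).card ≤
      (I.filter fun t => (S.filter fun v => t ∈ A v).card ≤ 1).card +
        S.card * (I.filter fun t => ¬ (S.filter fun v => t ∈ A v).card ≤ 1).card := by
  have hcount : ∑ v ∈ S, (A v).card = ∑ t ∈ I, (S.filter fun v => t ∈ A v).card := by
    have h := Finset.sum_card_bipartiteAbove_eq_sum_card_bipartiteBelow
      (s := S) (t := I) (fun v t => t ∈ A v)
    simp only [Finset.bipartiteAbove, Finset.bipartiteBelow] at h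
    rw [← h]
    refine Finset.sum_congr rfl fun v hv => ?_
    rw [Finset.filter_mem_eq_inter, Finset.inter_eq_right.mpr (hA v hv)]
  rw [hcount, ← Finset.sum_filter_add_sum_filter_not I
    (fun t => (S.filter fun v => t ∈ A v).card ≤ 1)]
  refine add_le_add ?_ ?_
  · refine (Finset.sum_le_card_nsmul _ _ 1 ?_).trans_eq (by simp)
    exact fun t ht => (Finset.mem_filter.mp ht).2
  · refine (Finset.sum_le_card_nsmul _ _ S.card ?_).trans_eq (by rw [smul_eq_mul, mul_comm])
    exact fun t _ => Finset.card_filter_le S _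

/-- If `|S| ≥ 2/ε` and every node of `S` has at least an `ε`-fraction of
non-jammed rounds, then the rounds in which at most one node of `S` is
non-jammed form at most a `(1-ε/2)`-fraction of the window. -/
theorem card_rounds_at_most_one_nonjammed {ι ν : Type*} [DecidableEq ι]
    (ε : ℝ) (hε0 : 0 < ε) (hε1 : ε < 1)
    (I : Finset ι) (hI : I.Nonempty) (S : Finset ν)
    (hS : (2 / ε : ℝ) ≤ S.card) (A : ν → Finset ι)
    (hAsub : ∀ v ∈ S, A v ⊆ I)
    (hAcard : ∀ v ∈ S, (ε * I.card : ℝ) ≤ (A v).card) :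
    (((I.filter fun t => (S.filter fun v => t ∈ A v).card ≤ 1).card : ℝ)) ≤
      (1 - ε / 2) * I.card := by
  have hcount := sum_card_le_card_filter_le_one_add I S A hAsub
  have hsplit := Finset.card_filter_add_card_filter_not (s := I)
    (fun t => (S.filter fun v => t ∈ A v).card ≤ 1)
  set J := I.filter fun t => (S.filter fun v => t ∈ A v).card ≤ 1
  set K := I.filter fun t => ¬ (S.filter fun v => t ∈ A v).card ≤ 1
  have hlow : (S.card : ℝ) * (ε * I.card) ≤ ∑ v ∈ S, ((A v).card : ℝ) := by
    simpa using Finset.card_nsmul_le_sum S (fun v => ((A v).card : ℝ)) _ hAcard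
  have hupp : ∑ v ∈ S, ((A v).card : ℝ) ≤ J.card + S.card * K.card := mod_cast hcount
  have hJK : (J.card : ℝ) + K.card = I.card := mod_cast hsplit
  have hS_pos : (0 : ℝ) < S.card := lt_of_lt_of_le (by positivity) hS
  have hI_le : 2 * (I.card : ℝ) ≤ S.card * ε * I.card :=
    mul_le_mul_of_nonneg_right ((div_le_iff₀ hε0).mp hS) (Nat.cast_nonneg _)
  have hK : (K.card : ℝ) = I.card - J.card := by linarith
  rw [hK] at hupp
  have hJ_le : (J.card : ℝ) ≤ I.card := mod_cast Finset.card_filter_le I _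
  refine le_of_mul_le_mul_left ?_ hS_pos
  linarith
end

section
/- Let 0 < ε < 1, let I be a nonempty finite set of rounds, let S be a finite set of nodes with |S| ≥ 2/ε, and for each v ∈ S let A_v ⊆ I with |A_v| ≥ ε·|I|. Let J = { t ∈ I : at most one v ∈ S has t ∈ A_v }, and for each v let o_v = |A_v \ J| (the open rounds of v). Then ∑_{v ∈ S} o_v ≥ (1/2) · ∑_{v ∈ S} |A_v|. -/
/-- Double counting: if every element of `J` lies in at most `n` of the sets `A v`, `v ∈ S`,
then the traces of these sets on `J` have total size at most `n * |J|`. -/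
theorem sum_card_inter_le_mul_card {ι ν : Type*} [DecidableEq ι] (J : Finset ι) (S : Finset ν)
    (A : ν → Finset ι) (n : ℕ) (h : ∀ t ∈ J, (S.filter fun v => t ∈ A v).card ≤ n) :
    ∑ v ∈ S, (A v ∩ J).card ≤ n * J.card := by
  have hcount : ∑ v ∈ S, (A v ∩ J).card = ∑ t ∈ J, (S.filter fun v => t ∈ A v).card := by
    refine Eq.trans (Finset.sum_congr rfl fun v _ => ?_)
      (Finset.sum_card_bipartiteAbove_eq_sum_card_bipartiteBelow (fun v t => t ∈ A v))
    rw [Finset.inter_comm, ← Finset.filter_mem_eq_inter]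
    rfl
  rw [hcount, mul_comm]
  exact Finset.sum_le_card_nsmul J _ n h

/-- The open rounds of the nodes of `S` make up at least half of their
non-jammed rounds, when `|S| ≥ 2/ε` and every node has at least an
`ε`-fraction of non-jammed rounds. -/
theorem sum_open_rounds_ge_half {ι ν : Type*} [DecidableEq ι]
    (ε : ℝ) (hε0 : 0 < ε) (hε1 : ε < 1)
    (I : Finset ι) (hI : I.Nonempty) (S : Finset ν)
    (hS : (2 / ε : ℝ) ≤ S.card) (A : ν → Finset ι)
    (hAsub : ∀ v ∈ S, A v ⊆ I)
    (hAcard : ∀ v ∈ S, (ε * I.card : ℝ) ≤ (A v).card) :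
    ∑ v ∈ S, ((((A v) \ (I.filter fun t => (S.filter fun v => t ∈ A v).card ≤ 1)).card : ℝ)) ≥
      (1 / 2) * ∑ v ∈ S, ((A v).card : ℝ) := by
  set J := I.filter fun t => (S.filter fun v => t ∈ A v).card ≤ 1
  have hinter : ∑ v ∈ S, ((A v ∩ J).card : ℝ) ≤ I.card := by
    have h := sum_card_inter_le_mul_card J S A 1 fun t ht => (Finset.mem_filter.mp ht).2
    rw [one_mul] at h
    exact_mod_cast h.trans (Finset.card_filter_le _ _)
  have hsplit : ∑ v ∈ S, ((A v).card : ℝ) =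
      ∑ v ∈ S, ((A v \ J).card : ℝ) + ∑ v ∈ S, ((A v ∩ J).card : ℝ) := by
    rw [← Finset.sum_add_distrib]
    exact Finset.sum_congr rfl fun v _ => mod_cast (Finset.card_sdiff_add_card_inter _ _).symm
  have hlower : (S.card : ℝ) * (ε * I.card) ≤ ∑ v ∈ S, ((A v).card : ℝ) := by
    simpa using Finset.card_nsmul_le_sum S (fun v => ((A v).card : ℝ)) _ hAcard
  have htwo : (2 : ℝ) * I.card ≤ S.card * (ε * I.card) := by
    rw [← mul_assoc]
    exact mul_le_mul_of_nonneg_right ((div_le_iff₀ hε0).mp hS) (Nat.cast_nonneg _)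
  linarith
end

section
/- Let V be a finite set of points in the Euclidean plane ℝ² and R > 0. Then there exists a subset U ⊆ V such that: (i) for every v ∈ V there is some u ∈ U with dist(v, u) ≤ R; and (ii) for every v ∈ V, the number of points u ∈ U with dist(v, u) ≤ R is at most 6. (Such a set U is a dominating set of constant density for the disks of radius R, and can be constructed greedily.) -/
/-- A maximal `R`-separated subset of a finite set dominates it. -/
theorem exists_separated_dominating_subset {α : Type*} [PseudoMetricSpace α]
    (V : Finset α) {R : ℝ} (hR : 0 ≤ R) :
    ∃ U ⊆ V, (∀ v ∈ V, ∃ u ∈ U, dist v u ≤ R) ∧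
      ∀ a ∈ U, ∀ b ∈ U, a ≠ b → R < dist a b := by
  classical
  induction V using Finset.induction_on with
  | empty => exact ⟨∅, by simp⟩
  | insert a V ha ih =>
    obtain ⟨U, hUV, hdom, hsep⟩ := ih
    by_cases h : ∃ u ∈ U, dist a u ≤ R
    · refine ⟨U, hUV.trans (Finset.subset_insert _ _), ?_, hsep⟩
      intro v hv
      rcases Finset.mem_insert.1 hv with rfl | hv
      · exact h
      · exact hdom v hv
    · push Not at h
      refine ⟨insert a U, Finset.insert_subset_insert _ hUV, ?_, ?_⟩
      · intro v hv
        rcases Finset.mem_insert.1 hv with rfl | hv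
        · exact ⟨v, Finset.mem_insert_self _ _, by simpa using hR⟩
        · obtain ⟨u, hu, huv⟩ := hdom v hv
          exact ⟨u, Finset.mem_insert_of_mem hu, huv⟩
      · intro b hb c hc hbc
        rcases Finset.mem_insert.1 hb with rfl | hbU <;>
          rcases Finset.mem_insert.1 hc with rfl | hcU
        · exact absurd rfl hbc
        · exact h c hcU
        · rw [dist_comm]
          exact h b hbU
        · exact hsep b hbU c hcU hbc

/-- The form `p² + pq + q²` of a difference of two points of the positive quadrant is bounded by
any common bound of its values at the two points. -/
theorem hexForm_sub_le_of_nonneg {p q p' q' S : ℝ} (hp : 0 ≤ p) (hq : 0 ≤ q)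
    (hp' : 0 ≤ p') (hq' : 0 ≤ q') (h : p ^ 2 + p * q + q ^ 2 ≤ S)
    (h' : p' ^ 2 + p' * q' + q' ^ 2 ≤ S) :
    (p - p') ^ 2 + (p - p') * (q - q') + (q - q') ^ 2 ≤ S := by
  rcases le_total p p' with h1 | h1 <;> rcases le_total q q' with h2 | h2
  · nlinarith [mul_nonneg hp hp', mul_nonneg hq hq', mul_nonneg hp hq, mul_nonneg hp' hq',
      mul_nonneg hp (sub_nonneg.2 h1), mul_nonneg hq (sub_nonneg.2 h2),
      mul_nonneg hp (sub_nonneg.2 h2), mul_nonneg hq (sub_nonneg.2 h1)]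
  · rcases le_total (p' - p) (q - q') with h3 | h3
    · nlinarith [mul_nonneg (sub_nonneg.2 h1) (sub_nonneg.2 h3), mul_nonneg hp hq,
        mul_nonneg hq' hq, mul_nonneg hq' (sub_nonneg.2 h2)]
    · nlinarith [mul_nonneg (sub_nonneg.2 h2) (sub_nonneg.2 h3), mul_nonneg hp' hq',
        mul_nonneg hp hp', mul_nonneg hp (sub_nonneg.2 h1)]
  · rcases le_total (p - p') (q' - q) with h3 | h3
    · nlinarith [mul_nonneg (sub_nonneg.2 h1) (sub_nonneg.2 h3), mul_nonneg hp' hq',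
        mul_nonneg hq' hq, mul_nonneg hq (sub_nonneg.2 h2)]
    · nlinarith [mul_nonneg (sub_nonneg.2 h2) (sub_nonneg.2 h3), mul_nonneg hp hq,
        mul_nonneg hp hp', mul_nonneg hp' (sub_nonneg.2 h1)]
  · nlinarith [mul_nonneg hp hp', mul_nonneg hq hq', mul_nonneg hp hq, mul_nonneg hp' hq',
      mul_nonneg hp' (sub_nonneg.2 h1), mul_nonneg hq' (sub_nonneg.2 h2),
      mul_nonneg hp' (sub_nonneg.2 h2), mul_nonneg hq' (sub_nonneg.2 h1)]

/-- The signs of `u`, `w`, `u + w` determine one of the six sectors of the plane cut out by the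
lines on which these linear forms vanish; the form `u² + uw + w²` of a difference of two points of
the same sector is bounded by any common bound of its values at the two points. -/
theorem hexForm_sub_le {u w u' w' S : ℝ} (hu : 0 ≤ u ↔ 0 ≤ u') (hw : 0 ≤ w ↔ 0 ≤ w')
    (hs : 0 ≤ u + w ↔ 0 ≤ u' + w') (h : u ^ 2 + u * w + w ^ 2 ≤ S)
    (h' : u' ^ 2 + u' * w' + w' ^ 2 ≤ S) :
    (u - u') ^ 2 + (u - u') * (w - w') + (w - w') ^ 2 ≤ S := by
  by_cases h1 : 0 ≤ u <;> by_cases h2 : 0 ≤ w <;> by_cases h3 : 0 ≤ u + w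
  all_goals
    have h1' := h1
    have h2' := h2
    have h3' := h3
    rw [hu] at h1'
    rw [hw] at h2'
    rw [hs] at h3'
    try rw [not_le] at h1 h1'
    try rw [not_le] at h2 h2'
    try rw [not_le] at h3 h3'
  · exact hexForm_sub_le_of_nonneg h1 h2 h1' h2' h h'
  · linarith
  · have := hexForm_sub_le_of_nonneg (p := u + w) (q := -w) (p' := u' + w') (q' := -w') (S := S)
      h3 (by linarith) h3' (by linarith) (by linarith) (by linarith)
    linarith
  · have := hexForm_sub_le_of_nonneg (p := u) (q := -(u + w)) (p' := u') (q' := -(u' + w')) (S := S)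
      h1 (by linarith) h1' (by linarith) (by linarith) (by linarith)
    linarith
  · have := hexForm_sub_le_of_nonneg (p := u + w) (q := -u) (p' := u' + w') (q' := -u') (S := S)
      h3 (by linarith) h3' (by linarith) (by linarith) (by linarith)
    linarith
  · have := hexForm_sub_le_of_nonneg (p := w) (q := -(u + w)) (p' := w') (q' := -(u' + w')) (S := S)
      h2 (by linarith) h2' (by linarith) (by linarith) (by linarith)
    linarith
  · linarith
  · have := hexForm_sub_le_of_nonneg (p := -u) (q := -w) (p' := -u') (q' := -w') (S := S)
      (by linarith) (by linarith) (by linarith) (by linarith) (by linarith) (by linarith)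
    linarith

/-- A closed disk of radius `R` in the plane contains at most six points at pairwise distance
greater than `R`. -/
theorem card_le_six_of_separated_of_dist_le (T : Finset (EuclideanSpace ℝ (Fin 2))) {R : ℝ}
    (hR : 0 ≤ R) (v : EuclideanSpace ℝ (Fin 2)) (hT : ∀ u ∈ T, dist v u ≤ R)
    (hsep : ∀ a ∈ T, ∀ b ∈ T, a ≠ b → R < dist a b) : T.card ≤ 6 := by
  classical
  by_contra! hcard
  have h3 : √(3 : ℝ) ^ 2 = 3 := Real.sq_sqrt (by norm_num)
  have h3pos : 0 < √(3 : ℝ) := Real.sqrt_pos.2 (by norm_num)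
  let f : EuclideanSpace ℝ (Fin 2) → ℝ := fun a => (a 0 - v 0) - (a 1 - v 1) / √3
  let g : EuclideanSpace ℝ (Fin 2) → ℝ := fun a => 2 * (a 1 - v 1) / √3
  have key (x y : ℝ) :
      (x - y / √3) ^ 2 + (x - y / √3) * (2 * y / √3) + (2 * y / √3) ^ 2 = x ^ 2 + y ^ 2 := by
    field_simp
    linear_combination -y ^ 2 * h3
  have hdist (a b : EuclideanSpace ℝ (Fin 2)) :
      dist a b ^ 2 = (a 0 - b 0) ^ 2 + (a 1 - b 1) ^ 2 := by
    rw [EuclideanSpace.dist_eq, Real.sq_sqrt (by positivity)]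
    simp [Real.dist_eq, sq_abs]
  have hball : ∀ a ∈ T, f a ^ 2 + f a * g a + g a ^ 2 ≤ R ^ 2 := by
    intro a ha
    have := pow_le_pow_left₀ dist_nonneg (hT a ha) 2
    rw [dist_comm, hdist] at this
    exact (key _ _).trans_le this
  let sector : EuclideanSpace ℝ (Fin 2) → Bool × Bool × Bool := fun a =>
    (decide (0 ≤ f a), decide (0 ≤ g a), decide (0 ≤ f a + g a))
  let sectors : Finset (Bool × Bool × Bool) := {(true, true, false), (false, false, true)}ᶜ
  have hmaps : ∀ a ∈ T, sector a ∈ sectors := by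
    intro a _
    simp only [sectors, sector, Finset.mem_compl, Finset.mem_insert, Finset.mem_singleton,
      Prod.mk.injEq, decide_eq_true_eq, decide_eq_false_iff_not, not_le]
    rintro (⟨h1, h2, h3⟩ | ⟨h1, h2, h3⟩) <;> linarith
  have hsectors : sectors.card = 6 := by decide
  obtain ⟨a, ha, b, hb, hab, heq⟩ :=
    Finset.exists_ne_map_eq_of_card_lt_of_maps_to (hsectors ▸ hcard) hmaps
  simp only [sector, Prod.mk.injEq, decide_eq_decide] at heq
  have hle := hexForm_sub_le heq.1 heq.2.1 heq.2.2 (hball a ha) (hball b hb)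
  have hf : f a - f b = (a 0 - b 0) - (a 1 - b 1) / √3 := by
    simp only [f]
    ring
  have hg : g a - g b = 2 * (a 1 - b 1) / √3 := by
    simp only [g]
    ring
  rw [hf, hg, key, ← hdist] at hle
  exact absurd (le_of_sq_le_sq hle hR) (not_le.2 (hsep a ha b hb hab))

/-- Every finite set of points in the plane has a dominating set of constant
density for disks of radius `R`: every point is within distance `R` of the
dominating set, and every point is within distance `R` of at most 6 dominators. -/
theorem exists_dominating_set_constant_density
    (V : Finset (EuclideanSpace ℝ (Fin 2))) (R : ℝ) (hR : 0 < R) :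
    ∃ U ⊆ V, (∀ v ∈ V, ∃ u ∈ U, dist v u ≤ R) ∧
      (∀ v ∈ V, (U.filter fun u => dist v u ≤ R).card ≤ 6) := by
  obtain ⟨U, hUV, hdom, hsep⟩ := exists_separated_dominating_subset V hR.le
  refine ⟨U, hUV, hdom, fun v _ => card_le_six_of_separated_of_dist_le _ hR.le v ?_ ?_⟩
  · exact fun u hu => (Finset.mem_filter.1 hu).2
  · exact fun a ha b hb => hsep a (Finset.mem_filter.1 ha).1 b (Finset.mem_filter.1 hb).1
end
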